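/- arXiv:2512.20552 — 4 statements merged into one kernel-verified Lean document; each statement's English description precedes it below -/
import Mathlib

section
/- Let V be a finite collection of jointly distributed finite-valued random variables equipped with a bivariate partial information decomposition whose atoms are nonnegative, satisfy the consistency equations, and satisfy monotonicity of unique information. Let X_i, X_j be distinct members of V. If there exists a conditioning set C ⊆ V \ {X_i, X_j} such that I(X_i; X_j | C) = 0, then the unique information of X_j about the target X_i relative to the supervariable complement is zero: Uniq^{V'}(X_j; X_i) = 0. -/
open scoped BigOperators

/-- A probability mass function on a finite outcome space `Ω`. -/
structure FinProb (Ω : Type*) [Fintype Ω] where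
  p : Ω → ℝ
  nonneg : ∀ ω, 0 ≤ p ω
  sum_one : ∑ ω, p ω = 1

/-- The probability that the finite-valued random variable `X` takes the value `a`. -/
def prob {Ω : Type*} [Fintype Ω] {α : Type*} [DecidableEq α]
    (μ : FinProb Ω) (X : Ω → α) (a : α) : ℝ :=
  ∑ ω, if X ω = a then μ.p ω else 0

/-- Shannon mutual information `I(X ; Y)` of two finite-valued random variables
(natural logarithm; the convention `0 · log 0 = 0` holds since `Real.log 0 = 0`). -/
noncomputable def MI {Ω : Type*} [Fintype Ω] {α β : Type*}
    [Fintype α] [DecidableEq α] [Fintype β] [DecidableEq β]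
    (μ : FinProb Ω) (X : Ω → α) (Y : Ω → β) : ℝ :=
  ∑ a : α, ∑ b : β,
    prob μ (fun ω => (X ω, Y ω)) (a, b) *
      Real.log (prob μ (fun ω => (X ω, Y ω)) (a, b) /
        (prob μ X a * prob μ Y b))

/-- Conditional mutual information `I(X ; Y ∣ Z)` of finite-valued random variables. -/
noncomputable def condMI {Ω : Type*} [Fintype Ω] {α β γ : Type*}
    [Fintype α] [DecidableEq α] [Fintype β] [DecidableEq β] [Fintype γ] [DecidableEq γ]
    (μ : FinProb Ω) (X : Ω → α) (Y : Ω → β) (Z : Ω → γ) : ℝ :=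
  ∑ a : α, ∑ b : β, ∑ c : γ,
    prob μ (fun ω => (X ω, Y ω, Z ω)) (a, b, c) *
      Real.log ((prob μ Z c * prob μ (fun ω => (X ω, Y ω, Z ω)) (a, b, c)) /
        (prob μ (fun ω => (X ω, Z ω)) (a, c) * prob μ (fun ω => (Y ω, Z ω)) (b, c)))

/-- The joint random variable (supervariable) of the subfamily of `X` indexed by `s`. -/
def jointRV {Ω V α : Type*} [DecidableEq V]
    (X : V → Ω → α) (s : Finset V) : Ω → (V → Option α) :=
  fun ω i => if i ∈ s then some (X i ω) else none

/-- A bivariate partial information decomposition (PID) attached to the family `X`: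
for each pair of source index sets `A, B` and target `t` it provides nonnegative atoms
`Red A B t = Red(X_A, X_B ; X_t)`, `Uniq A B t = Uniq(X_A ; X_t ∣ X_B)` and
`Syn A B t = Syn(X_A, X_B ; X_t)` satisfying the consistency equations. -/
structure BivPID {Ω V α : Type*} [Fintype Ω] [Fintype V] [DecidableEq V]
    [Fintype α] [DecidableEq α] (μ : FinProb Ω) (X : V → Ω → α) where
  Red : Finset V → Finset V → V → ℝ
  Uniq : Finset V → Finset V → V → ℝ
  Syn : Finset V → Finset V → V → ℝ
  red_nonneg : ∀ A B t, 0 ≤ Red A B t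
  uniq_nonneg : ∀ A B t, 0 ≤ Uniq A B t
  syn_nonneg : ∀ A B t, 0 ≤ Syn A B t
  consistency_fst : ∀ A B t, MI μ (jointRV X A) (X t) = Red A B t + Uniq A B t
  consistency_snd : ∀ A B t, MI μ (jointRV X B) (X t) = Red A B t + Uniq B A t
  consistency_joint : ∀ A B t,
    MI μ (jointRV X (A ∪ B)) (X t) =
      Red A B t + Uniq A B t + Uniq B A t + Syn A B t

variable {Ω V α : Type*} [Fintype Ω] [Fintype V] [DecidableEq V] [Fintype α] [DecidableEq α]

/-- Monotonicity of unique information: augmenting the other source with further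
variables cannot increase the unique information of a source. -/
def BivPID.UniqMono {μ : FinProb Ω} {X : V → Ω → α} (P : BivPID μ X) : Prop :=
  ∀ A B K t, P.Uniq A (B ∪ K) t ≤ P.Uniq A B t

/-- Information monotonicity: augmenting a source with further variables cannot
decrease the synergy atom containing it. -/
def BivPID.SynMono {μ : FinProb Ω} {X : V → Ω → α} (P : BivPID μ X) : Prop :=
  ∀ A B K t, P.Syn A B t ≤ P.Syn (A ∪ K) B t

/-- `Uniq^{V'}(X_j ; X_i)` : unique information of `X_j` about the target `X_i`
relative to the supervariable of all the remaining variables. -/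
def BivPID.uniqC {μ : FinProb Ω} {X : V → Ω → α} (P : BivPID μ X) (j i : V) : ℝ :=
  P.Uniq {j} (Finset.univ \ {i, j}) i

/-- Persistent relevance: a variable whose conditional mutual information with the
target is positive for every conditioning set has positive unique information. -/
def BivPID.PersistentRelevance {μ : FinProb Ω} {X : V → Ω → α} (P : BivPID μ X) : Prop :=
  ∀ i t : V, i ≠ t →
    (∀ C : Finset V, C ⊆ Finset.univ \ {i, t} →
      0 < condMI μ (X i) (X t) (jointRV X C)) →
    0 < P.uniqC i t

section ChainRule

variable {β γ δ : Type*} [DecidableEq β] [DecidableEq γ] [DecidableEq δ]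

theorem prob_apply_congr (μ : FinProb Ω) (X : Ω → β) (Y : Ω → γ) (ω : Ω)
    (h : ∀ ω', X ω' = X ω ↔ Y ω' = Y ω) : prob μ X (X ω) = prob μ Y (Y ω) := by
  simp only [prob, h]

theorem prob_apply_pos (μ : FinProb Ω) (X : Ω → β) {ω : Ω} (h : 0 < μ.p ω) :
    0 < prob μ X (X ω) := by
  refine Finset.sum_pos' (fun ω' _ => ?_) ⟨ω, Finset.mem_univ ω, by simpa using h⟩
  split_ifs
  exacts [μ.nonneg ω', le_rfl]

variable [Fintype β] [Fintype γ] [Fintype δ]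

/-- The expectation of `f ∘ X`, computed over the values of `X` or over the outcomes. -/
theorem sum_prob_mul (μ : FinProb Ω) (X : Ω → β) (f : β → ℝ) :
    ∑ a, prob μ X a * f a = ∑ ω, μ.p ω * f (X ω) := by
  simp only [prob, Finset.sum_mul]
  rw [Finset.sum_comm]
  simp [ite_mul]

theorem MI_eq_sum (μ : FinProb Ω) (X : Ω → β) (Y : Ω → γ) :
    MI μ X Y = ∑ ω, μ.p ω * Real.log (prob μ (fun ω => (X ω, Y ω)) (X ω, Y ω) /
      (prob μ X (X ω) * prob μ Y (Y ω))) := by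
  rw [← sum_prob_mul μ (fun ω => (X ω, Y ω)) (fun q =>
    Real.log (prob μ (fun ω => (X ω, Y ω)) q / (prob μ X q.1 * prob μ Y q.2))),
    Fintype.sum_prod_type]
  rfl

theorem condMI_eq_sum (μ : FinProb Ω) (X : Ω → β) (Y : Ω → γ) (Z : Ω → δ) :
    condMI μ X Y Z = ∑ ω, μ.p ω *
      Real.log ((prob μ Z (Z ω) * prob μ (fun ω => (X ω, Y ω, Z ω)) (X ω, Y ω, Z ω)) /
        (prob μ (fun ω => (X ω, Z ω)) (X ω, Z ω) *
          prob μ (fun ω => (Y ω, Z ω)) (Y ω, Z ω))) := by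
  rw [← sum_prob_mul μ (fun ω => (X ω, Y ω, Z ω)) (fun q =>
    Real.log ((prob μ Z q.2.2 * prob μ (fun ω => (X ω, Y ω, Z ω)) q) /
      (prob μ (fun ω => (X ω, Z ω)) (q.1, q.2.2) * prob μ (fun ω => (Y ω, Z ω)) q.2))),
    Fintype.sum_prod_type]
  simp only [Fintype.sum_prod_type]
  rfl

/-- Chain rule: if `W` carries the same information as the pair `(Y, Z)`, then
`I(W ; T) = I(Z ; T) + I(T ; Y ∣ Z)`. -/
theorem MI_eq_MI_add_condMI {ε : Type*} [Fintype ε] [DecidableEq ε] (μ : FinProb Ω)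
    (T : Ω → β) (Y : Ω → γ) (Z : Ω → δ) (W : Ω → ε)
    (hW : ∀ ω ω', W ω' = W ω ↔ Y ω' = Y ω ∧ Z ω' = Z ω) :
    MI μ W T = MI μ Z T + condMI μ T Y Z := by
  rw [MI_eq_sum, MI_eq_sum, condMI_eq_sum, ← Finset.sum_add_distrib]
  refine Finset.sum_congr rfl fun ω _ => ?_
  rcases (μ.nonneg ω).eq_or_lt with hp | hp
  · simp [← hp]
  rw [prob_apply_congr μ W (fun ω => (Y ω, Z ω)) ω (by simp [hW]),
    prob_apply_congr μ (fun ω => (W ω, T ω)) (fun ω => (T ω, Y ω, Z ω)) ω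
      (fun ω' => by simp only [Prod.mk.injEq, hW]; tauto),
    prob_apply_congr μ (fun ω => (Z ω, T ω)) (fun ω => (T ω, Z ω)) ω
      (fun ω' => by simp only [Prod.mk.injEq]; tauto), ← mul_add]
  have hT := prob_apply_pos μ T hp
  have hZ := prob_apply_pos μ Z hp
  have hYZ := prob_apply_pos μ (fun ω => (Y ω, Z ω)) hp
  have hTZ := prob_apply_pos μ (fun ω => (T ω, Z ω)) hp
  have hTYZ := prob_apply_pos μ (fun ω => (T ω, Y ω, Z ω)) hp
  rw [← Real.log_mul (by positivity) (by positivity)]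
  congr 2
  field_simp

end ChainRule

theorem jointRV_singleton_union_eq_iff {Ω V α : Type*} [DecidableEq V] (X : V → Ω → α) (j : V)
    (C : Finset V) (ω ω' : Ω) :
    jointRV X ({j} ∪ C) ω' = jointRV X ({j} ∪ C) ω ↔
      X j ω' = X j ω ∧ jointRV X C ω' = jointRV X C ω := by
  have key : ∀ s : Finset V, jointRV X s ω' = jointRV X s ω ↔ ∀ k ∈ s, X k ω' = X k ω := by
    intro s
    simp only [jointRV, funext_iff]
    refine forall_congr' fun k => ?_
    by_cases hk : k ∈ s <;> simp [hk]
  simp [key]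

/-- If some conditioning set `C ⊆ V \ {X_i, X_j}` renders `X_i` and
`X_j` conditionally independent, then `X_j` has zero unique information about the
target `X_i` relative to the supervariable complement. -/
theorem conditional_independence_implies_zero_unique
    {Ω V α : Type*} [Fintype Ω] [Fintype V] [DecidableEq V] [Fintype α] [DecidableEq α]
    (μ : FinProb Ω) (X : V → Ω → α)
    (P : BivPID μ X) (hmono : P.UniqMono)
    (i j : V) (hij : i ≠ j)
    (C : Finset V) (hC : C ⊆ Finset.univ \ {i, j})
    (h0 : condMI μ (X i) (X j) (jointRV X C) = 0) :
    P.uniqC j i = 0 := by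
  have hchain := MI_eq_MI_add_condMI μ (X i) (X j) (jointRV X C) (jointRV X ({j} ∪ C))
    (jointRV_singleton_union_eq_iff X j C)
  have hle := hmono {j} C (Finset.univ \ {i, j}) i
  rw [Finset.union_eq_right.mpr hC] at hle
  have hjoint := P.consistency_joint {j} C i
  have hsnd := P.consistency_snd {j} C i
  have hsyn := P.syn_nonneg {j} C i
  exact le_antisymm (hle.trans (by linarith)) (P.uniq_nonneg _ _ _)
end

section
/- In a DAG G, if vertices X_i and X_j are non-adjacent and X_j is not a descendant of X_i, then the parent set pa(X_i) d-separates X_i from X_j. Consequently, any two non-adjacent vertices of a DAG are d-separated by the parent set of one of them. -/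
/-- `a → m ← b` is a collider configuration at `m`. -/
def IsCollider {V : Type*} (adj : V → V → Prop) (a m b : V) : Prop :=
  adj a m ∧ adj b m

/-- A trail (undirected path) in a directed graph: consecutive vertices are adjacent
in one direction or the other, and no vertex repeats. -/
def IsTrail {V : Type*} (adj : V → V → Prop) (p : List V) : Prop :=
  List.Chain' (fun u v => adj u v ∨ adj v u) p ∧ p.Nodup

/-- The interior triple `a - m - b` blocks a trail relative to `C` if `m` is a
non-collider lying in `C`, or `m` is a collider none of whose descendants
(including `m` itself) lies in `C`. -/
def BlocksAt {V : Type*} (adj : V → V → Prop) (C : Finset V) (a m b : V) : Prop :=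
  (¬ IsCollider adj a m b ∧ m ∈ C) ∨
    (IsCollider adj a m b ∧ ∀ d, Relation.ReflTransGen adj m d → d ∉ C)

/-- A trail is blocked by `C` if some consecutive interior triple blocks it. -/
def BlockedTrail {V : Type*} (adj : V → V → Prop) (C : Finset V) (p : List V) : Prop :=
  ∃ a m b, [a, m, b] <:+: p ∧ BlocksAt adj C a m b

/-- d-separation: `C` d-separates `x` from `y` if every trail from `x` to `y`
is blocked by `C`. -/
def DSep {V : Type*} (adj : V → V → Prop) (C : Finset V) (x y : V) : Prop :=
  ∀ p : List V, IsTrail adj p → p.head? = some x → p.getLast? = some y →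
    BlockedTrail adj C p

/-- A directed graph is acyclic if no vertex lies on a directed cycle. -/
def AcyclicDigraph {V : Type*} (adj : V → V → Prop) : Prop :=
  ∀ v, ¬ Relation.TransGen adj v v

/-- The set of parents of `i`. -/
def parentSet {V : Type*} [Fintype V] (adj : V → V → Prop) [DecidableRel adj]
    (i : V) : Finset V :=
  Finset.univ.filter (fun u => adj u i)

theorem BlocksAt.symm {V : Type*} {adj : V → V → Prop} {C : Finset V} {a m b : V}
    (h : BlocksAt adj C a m b) : BlocksAt adj C b m a := by
  simpa only [BlocksAt, IsCollider, and_comm (a := adj b m)] using h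

theorem BlockedTrail.of_reverse {V : Type*} {adj : V → V → Prop} {C : Finset V} {p : List V}
    (h : BlockedTrail adj C p.reverse) : BlockedTrail adj C p := by
  obtain ⟨a, m, b, hp, hb⟩ := h
  refine ⟨b, m, a, ?_, hb.symm⟩
  rw [← List.reverse_infix]
  simpa using hp

theorem IsTrail.reverse {V : Type*} {adj : V → V → Prop} {p : List V}
    (h : IsTrail adj p) : IsTrail adj p.reverse := by
  refine ⟨List.isChain_reverse.2 (h.1.imp fun _ _ hab => hab.symm), List.nodup_reverse.2 h.2⟩

theorem DSep.symm {V : Type*} {adj : V → V → Prop} {C : Finset V} {x y : V}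
    (h : DSep adj C x y) : DSep adj C y x := fun p hp hy hx =>
  .of_reverse (h p.reverse hp.reverse (by simpa using hx) (by simpa using hy))

/-- Following a walk that enters a descendant `m` of `i` along an arrow and ends at a
non-descendant of `i`, one meets a collider that is a descendant of `i`. -/
theorem exists_collider_of_transGen {V : Type*} {adj : V → V → Prop} {i j : V}
    (hij : ¬ Relation.TransGen adj i j) :
    ∀ (l : List V) (a m : V), adj a m → Relation.TransGen adj i m →
      List.IsChain (fun u v => adj u v ∨ adj v u) (m :: l) → (m :: l).getLast? = some j →
      ∃ u c v, [u, c, v] <:+: a :: m :: l ∧ IsCollider adj u c v ∧ Relation.TransGen adj i c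
  | [], _, m, _, hm, _, hl => by
    obtain rfl : m = j := by simpa using hl
    exact absurd hm hij
  | b :: l, a, m, ham, hm, hc, hl => by
    rw [List.isChain_cons_cons] at hc
    rcases hc.1 with hmb | hbm
    · obtain ⟨u, c, v, hs, hcol⟩ := exists_collider_of_transGen hij l m b hmb (hm.tail hmb)
        hc.2 (by simpa [List.getLast?_cons_cons] using hl)
      exact ⟨u, c, v, List.infix_cons hs, hcol⟩
    · exact ⟨a, m, b, ⟨[], l, rfl⟩, ⟨ham, hbm⟩, hm⟩

/-- The local Markov property for d-separation. -/
theorem dSep_parentSet_of_not_transGen {V : Type*} [Fintype V] {adj : V → V → Prop}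
    [DecidableRel adj] (hacyc : AcyclicDigraph adj) {i j : V} (hne : i ≠ j)
    (hji : ¬ adj j i) (hij : ¬ Relation.TransGen adj i j) :
    DSep adj (parentSet adj i) i j := by
  rintro (_ | ⟨x, _ | ⟨m, l⟩⟩) ⟨hc, -⟩ hx hy
  · simp at hx
  · simp_all
  obtain rfl : x = i := by simpa using hx
  have hc := List.isChain_cons_cons.1 hc
  rw [List.getLast?_cons_cons] at hy
  rcases hc.1 with him | hmi
  · obtain ⟨u, c, v, hs, hcol, hic⟩ :=
      exists_collider_of_transGen hij l x m him (.single him) hc.2 hy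
    refine ⟨u, c, v, hs, .inr ⟨hcol, fun d hcd hd => hacyc x ?_⟩⟩
    exact (hic.trans_left hcd).tail (by simpa [parentSet] using hd)
  · rcases l with _ | ⟨b, l⟩
    · obtain rfl : m = j := by simpa using hy
      exact absurd hmi hji
    · refine ⟨x, m, b, ⟨[], l, rfl⟩, .inl ⟨fun h => hacyc x ?_, by simpa [parentSet] using hmi⟩⟩
      exact .tail (.single h.1) hmi

/-- In a DAG, if `i` and `j` are non-adjacent and `j` is not a
descendant of `i`, then the parents of `i` d-separate `i` from `j`; consequently any
two non-adjacent vertices are d-separated by the parent set of one of them. -/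
theorem parent_set_dseparates
    {V : Type*} [Fintype V] [DecidableEq V]
    (adj : V → V → Prop) [DecidableRel adj]
    (hacyc : AcyclicDigraph adj) :
    (∀ i j : V, i ≠ j → ¬ adj i j → ¬ adj j i →
        ¬ Relation.TransGen adj i j →
        DSep adj (parentSet adj i) i j) ∧
    (∀ i j : V, i ≠ j → ¬ adj i j → ¬ adj j i →
        DSep adj (parentSet adj i) i j ∨ DSep adj (parentSet adj j) i j) := by
  refine ⟨fun i j hne _ hji hij => dSep_parentSet_of_not_transGen hacyc hne hji hij,
    fun i j hne hij hji => ?_⟩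
  by_cases h : Relation.TransGen adj i j
  · exact .inr (dSep_parentSet_of_not_transGen hacyc hne.symm hij
      fun h' => hacyc i (h.trans h')).symm
  · exact .inl (dSep_parentSet_of_not_transGen hacyc hne hji h)
end

section
/- For a finite set S, the partially ordered set (A(S), ⪯) of antichains of nonempty subsets of S under the redundancy-lattice order is a lattice: every pair of elements α, β ∈ A(S) has a greatest lower bound (meet) and a least upper bound (join) with respect to ⪯. -/
/-- An element of the PID redundancy lattice over `S`: a collection of nonempty
subsets of `S`, none of which is a proper subset of another. -/
def IsPIDAntichain {S : Type*} [DecidableEq S] (A : Finset (Finset S)) : Prop :=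
  (∀ a ∈ A, a.Nonempty) ∧ ∀ a ∈ A, ∀ b ∈ A, ¬ a ⊂ b

/-- The redundancy-lattice order: `α ⪯ β` iff every member of `β` contains some
member of `α`. -/
def RLle {S : Type*} [DecidableEq S] (A B : Finset (Finset S)) : Prop :=
  ∀ b ∈ B, ∃ a ∈ A, a ⊆ b

theorem RLle.trans {S : Type*} [DecidableEq S] {A B C : Finset (Finset S)}
    (hAB : RLle A B) (hBC : RLle B C) : RLle A C := by
  intro c hc
  obtain ⟨b, hb, hbc⟩ := hBC c hc
  obtain ⟨a, ha, hab⟩ := hAB b hb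
  exact ⟨a, ha, hab.trans hbc⟩

/-- Every collection of nonempty sets is equivalent, for the redundancy-lattice preorder, to
the antichain of its minimal members. -/
theorem exists_isPIDAntichain_equiv {S : Type*} [DecidableEq S] (X : Finset (Finset S))
    (hX : ∀ a ∈ X, a.Nonempty) :
    ∃ N : Finset (Finset S), IsPIDAntichain N ∧ RLle N X ∧ RLle X N := by
  refine ⟨X.filter fun a => ∀ b ∈ X, ¬ b ⊂ a, ⟨?_, ?_⟩, ?_, ?_⟩
  · intro a ha
    exact hX a (Finset.mem_filter.1 ha).1
  · intro a ha b hb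
    exact (Finset.mem_filter.1 hb).2 a (Finset.mem_filter.1 ha).1
  · intro b hb
    obtain ⟨a, hab, ha⟩ := X.exists_le_minimal hb
    exact ⟨a, Finset.mem_filter.2 ⟨ha.prop, fun _ hc => ha.not_lt hc⟩, hab⟩
  · intro a ha
    exact ⟨a, (Finset.mem_filter.1 ha).1, subset_rfl⟩

/-- The poset of antichains of nonempty subsets of a finite set
`S` under the redundancy-lattice order is a lattice: every pair of antichains has a
greatest lower bound and a least upper bound. -/
theorem redundancy_lattice_is_lattice
    {S : Type*} [Fintype S] [DecidableEq S]
    (A B : Finset (Finset S)) (hA : IsPIDAntichain A) (hB : IsPIDAntichain B) :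
    (∃ M : Finset (Finset S), IsPIDAntichain M ∧ RLle M A ∧ RLle M B ∧
        ∀ C : Finset (Finset S), IsPIDAntichain C → RLle C A → RLle C B → RLle C M) ∧
    (∃ J : Finset (Finset S), IsPIDAntichain J ∧ RLle A J ∧ RLle B J ∧
        ∀ C : Finset (Finset S), IsPIDAntichain C → RLle A C → RLle B C → RLle J C) := by
  constructor
  · obtain ⟨M, hM, hMX, hXM⟩ := exists_isPIDAntichain_equiv (A ∪ B) fun a ha =>
      (Finset.mem_union.1 ha).elim (hA.1 a) (hB.1 a)
    refine ⟨M, hM, fun a ha => hMX a (Finset.mem_union_left _ ha),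
      fun b hb => hMX b (Finset.mem_union_right _ hb), fun C _ hCA hCB => RLle.trans ?_ hXM⟩
    exact fun x hx => (Finset.mem_union.1 hx).elim (hCA x) (hCB x)
  · obtain ⟨J, hJ, hJX, hXJ⟩ := exists_isPIDAntichain_equiv (Finset.image₂ (· ∪ ·) A B) <| by
      intro x hx
      obtain ⟨a, ha, b, -, rfl⟩ := Finset.mem_image₂.1 hx
      exact (hA.1 a ha).mono Finset.subset_union_left
    refine ⟨J, hJ, RLle.trans ?_ hXJ, RLle.trans ?_ hXJ,
      fun C _ hAC hBC => hJX.trans ?_⟩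
    · intro x hx
      obtain ⟨a, ha, b, -, rfl⟩ := Finset.mem_image₂.1 hx
      exact ⟨a, ha, Finset.subset_union_left⟩
    · intro x hx
      obtain ⟨a, -, b, hb, rfl⟩ := Finset.mem_image₂.1 hx
      exact ⟨b, hb, Finset.subset_union_right⟩
    · intro c hc
      obtain ⟨a, ha, hac⟩ := hAC c hc
      obtain ⟨b, hb, hbc⟩ := hBC c hc
      exact ⟨a ∪ b, Finset.mem_image₂_of_mem ha hb, Finset.union_subset hac hbc⟩
end

section
/- Let X_1, X_2, X_4 be independent uniformly distributed {0,1}-valued random variables, let X_3 = X_1 XOR X_2, and define the composite variables X_1' = (X_1, X_4), X_2' = (X_2, X_4), X_3' = (X_3, X_4). Then I(X_1'; X_3') = log 2 and I(X_1'; X_3' | X_2') = log 2; in particular, I(X_1'; X_3' | C) > 0 for every conditioning set C ⊆ {X_2'} (namely C = ∅ and C = {X_2'}). -/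
open scoped BigOperators

/-- The law of a function of `T` is the pushforward of the law of `T`. -/
theorem prob_comp {Ω : Type*} [Fintype Ω] {τ α : Type*} [Fintype τ] [DecidableEq τ]
    [DecidableEq α] (μ : FinProb Ω) (T : Ω → τ) (f : τ → α) (a : α) :
    prob μ (fun ω => f (T ω)) a = ∑ t, if f t = a then prob μ T t else 0 := by
  simp only [prob, ← Finset.sum_filter]
  rw [← Finset.sum_fiberwise_of_maps_to (t := Finset.univ.filter fun t => f t = a) (g := T)
    (by simp)]
  refine Finset.sum_congr rfl fun t ht => Finset.sum_congr ?_ fun _ _ => rfl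
  ext ω
  simp only [Finset.mem_filter, Finset.mem_univ, true_and] at ht ⊢
  exact ⟨And.right, fun h => ⟨h ▸ ht, h⟩⟩

/-- If every value of `T` has probability `q`, a function of `T` takes a value with probability
`q` times the number of its preimages. -/
theorem prob_comp_of_const {Ω : Type*} [Fintype Ω] {τ α : Type*} [Fintype τ] [DecidableEq τ]
    [DecidableEq α] {μ : FinProb Ω} {T : Ω → τ} {q : ℝ} (hT : ∀ t, prob μ T t = q)
    (f : τ → α) (a : α) :
    prob μ (fun ω => f (T ω)) a = (Finset.univ.filter fun t => f t = a).card * q := by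
  rw [prob_comp, ← Finset.sum_filter]
  simp [hT]

/-- For independent uniform bits `X₁, X₂, X₄`, with
`X₃ = X₁ XOR X₂` and composite variables `X₁' = (X₁, X₄)`, `X₂' = (X₂, X₄)`,
`X₃' = (X₃, X₄)`, one has `I(X₁' ; X₃') = log 2` and
`I(X₁' ; X₃' ∣ X₂') = log 2`; in particular both are positive, so
`I(X₁' ; X₃' ∣ C) > 0` for every conditioning set `C ⊆ {X₂'}`. -/
theorem xor_example_persistent_dependence
    {Ω : Type*} [Fintype Ω] (μ : FinProb Ω) (X₁ X₂ X₄ : Ω → Bool)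
    (huniform : ∀ a b c : Bool,
      prob μ (fun ω => (X₁ ω, X₂ ω, X₄ ω)) (a, b, c) = 1 / 8) :
    MI μ (fun ω => (X₁ ω, X₄ ω)) (fun ω => (xor (X₁ ω) (X₂ ω), X₄ ω)) = Real.log 2 ∧
    condMI μ (fun ω => (X₁ ω, X₄ ω)) (fun ω => (xor (X₁ ω) (X₂ ω), X₄ ω))
        (fun ω => (X₂ ω, X₄ ω)) = Real.log 2 ∧
    0 < MI μ (fun ω => (X₁ ω, X₄ ω)) (fun ω => (xor (X₁ ω) (X₂ ω), X₄ ω)) ∧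
    0 < condMI μ (fun ω => (X₁ ω, X₄ ω)) (fun ω => (xor (X₁ ω) (X₂ ω), X₄ ω))
        (fun ω => (X₂ ω, X₄ ω)) := by
  have hT : ∀ t : Bool × Bool × Bool, prob μ (fun ω => (X₁ ω, X₂ ω, X₄ ω)) t = 1 / 8 :=
    fun t => huniform t.1 t.2.1 t.2.2
  have law {α : Type} [DecidableEq α] (f : Bool × Bool × Bool → α) (a : α) (n : ℕ)
      (hn : (Finset.univ.filter fun t => f t = a).card = n) :
      prob μ (fun ω => f (X₁ ω, X₂ ω, X₄ ω)) a = n * (1 / 8) :=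
    hn ▸ prob_comp_of_const hT f a
  have h₁ (a) : prob μ (fun ω => (X₁ ω, X₄ ω)) a = (2 : ℕ) * (1 / 8) :=
    law (fun t => (t.1, t.2.2)) a 2 (by decide +revert)
  have h₂ (a) : prob μ (fun ω => (X₂ ω, X₄ ω)) a = (2 : ℕ) * (1 / 8) :=
    law (fun t => (t.2.1, t.2.2)) a 2 (by decide +revert)
  have h₃ (a) : prob μ (fun ω => (xor (X₁ ω) (X₂ ω), X₄ ω)) a = (2 : ℕ) * (1 / 8) :=
    law (fun t => (xor t.1 t.2.1, t.2.2)) a 2 (by decide +revert)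
  have h₁₃ (a b) : prob μ (fun ω => ((X₁ ω, X₄ ω), (xor (X₁ ω) (X₂ ω), X₄ ω))) (a, b) =
      (if a.2 = b.2 then 1 else 0 : ℕ) * (1 / 8) :=
    law (fun t => ((t.1, t.2.2), (xor t.1 t.2.1, t.2.2))) (a, b) _ (by decide +revert)
  have h₁₂ (a c) : prob μ (fun ω => ((X₁ ω, X₄ ω), (X₂ ω, X₄ ω))) (a, c) =
      (if a.2 = c.2 then 1 else 0 : ℕ) * (1 / 8) :=
    law (fun t => ((t.1, t.2.2), (t.2.1, t.2.2))) (a, c) _ (by decide +revert)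
  have h₃₂ (b c) : prob μ (fun ω => ((xor (X₁ ω) (X₂ ω), X₄ ω), (X₂ ω, X₄ ω))) (b, c) =
      (if b.2 = c.2 then 1 else 0 : ℕ) * (1 / 8) :=
    law (fun t => ((xor t.1 t.2.1, t.2.2), (t.2.1, t.2.2))) (b, c) _ (by decide +revert)
  have h₁₃₂ (a b c) : prob μ
      (fun ω => ((X₁ ω, X₄ ω), (xor (X₁ ω) (X₂ ω), X₄ ω), (X₂ ω, X₄ ω))) (a, b, c) =
      (if a.2 = b.2 ∧ b.2 = c.2 ∧ b.1 = xor a.1 c.1 then 1 else 0 : ℕ) * (1 / 8) :=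
    law (fun t => ((t.1, t.2.2), (xor t.1 t.2.1, t.2.2), (t.2.1, t.2.2))) (a, b, c) _
      (by decide +revert)
  have hMI : MI μ (fun ω => (X₁ ω, X₄ ω)) (fun ω => (xor (X₁ ω) (X₂ ω), X₄ ω)) =
      Real.log 2 := by
    simp only [MI, h₁, h₃, h₁₃, Fintype.sum_prod_type, Fintype.sum_bool]
    norm_num
    ring
  have hcondMI : condMI μ (fun ω => (X₁ ω, X₄ ω)) (fun ω => (xor (X₁ ω) (X₂ ω), X₄ ω))
      (fun ω => (X₂ ω, X₄ ω)) = Real.log 2 := by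
    simp only [condMI, h₂, h₁₂, h₃₂, h₁₃₂, Fintype.sum_prod_type, Fintype.sum_bool]
    norm_num
    ring
  have hlog : 0 < Real.log 2 := Real.log_pos one_lt_two
  exact ⟨hMI, hcondMI, hMI ▸ hlog, hcondMI ▸ hlog⟩
end
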